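/- arXiv:1605.08884 — 9 statements merged into one kernel-verified Lean document; each statement's English description precedes it below -/
import Mathlib

section
/- Every highly composite number is divisible by every prime less than its greatest prime divisor: if n is a highly composite number, p is a prime dividing n, and q is a prime with q < p, then q divides n. -/
/-- `n` is a highly composite number: `d(m) < d(n)` for all positive `m < n`. -/
def HighlyComposite (n : ℕ) : Prop :=
  0 < n ∧ ∀ m : ℕ, 0 < m → m < n → m.divisors.card < n.divisors.card

/-- Every highly composite number is divisible by every prime less than its
greatest prime divisor. -/
theorem hcn_divisible_by_smaller_primes (n p q : ℕ)
    (hn : HighlyComposite n) (hp : p.Prime) (hpn : p ∣ n)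
    (hq : q.Prime) (hqp : q < p) : q ∣ n := by
  by_contra hqn
  obtain ⟨hpos, hlt⟩ := hn
  obtain ⟨k, m, hpm, rfl⟩ := Nat.exists_eq_pow_mul_and_not_dvd hpos.ne' p hp.ne_one
  have hk : k ≠ 0 := by
    rintro rfl
    exact hpm (by simpa using hpn)
  have hm : 0 < m := Nat.pos_of_mul_pos_left hpos
  have hqm : ¬ q ∣ m := fun h => hqn (h.mul_left _)
  have hcard : (q ^ k * m).divisors.card = (p ^ k * m).divisors.card := by
    rw [Nat.Coprime.card_divisors_mul (((hq.coprime_iff_not_dvd).2 hqm).pow_left k),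
      Nat.Coprime.card_divisors_mul (((hp.coprime_iff_not_dvd).2 hpm).pow_left k),
      Nat.divisors_prime_pow hq, Nat.divisors_prime_pow hp, Finset.card_map, Finset.card_map]
  have hsmaller : q ^ k * m < p ^ k * m :=
    Nat.mul_lt_mul_of_pos_right (Nat.pow_lt_pow_left hqp hk) hm
  exact (hlt _ (Nat.mul_pos (Nat.pow_pos hq.pos) hm) hsmaller).ne hcard
end

section
/- (Lemma 2, single-step form.) Let n be a highly composite number, let p be a prime with p ∣ n and p² ∤ n, and let q be a prime with q > p and q ∤ n. Let n₁ be the smallest highly composite number greater than n. If the integer m = n·q/p satisfies m < n₁, then m is a largely composite number. -/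
/-- `n` is a largely composite number: `d(m) ≤ d(n)` for all positive `m < n`. -/
def LargelyComposite (n : ℕ) : Prop :=
  0 < n ∧ ∀ m : ℕ, 0 < m → m < n → m.divisors.card ≤ n.divisors.card

/-- Below the next highly composite number, no divisor count exceeds that of the current one. -/
theorem HighlyComposite.card_divisors_le_of_lt_next {n n₁ : ℕ} (hn : HighlyComposite n)
    (hmin : ∀ m : ℕ, HighlyComposite m → n < m → n₁ ≤ m) {j : ℕ} (hj : 0 < j) (hj₁ : j < n₁) :
    j.divisors.card ≤ n.divisors.card := by
  induction j using Nat.strong_induction_on with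
  | _ j ih =>
    rcases lt_trichotomy j n with h | rfl | h
    · exact (hn.2 j hj h).le
    · exact le_rfl
    · by_contra! hlt
      have hjc : HighlyComposite j :=
        ⟨hj, fun i hi hij => (ih i hij hi (hij.trans hj₁)).trans_lt hlt⟩
      exact (hmin j hjc h).not_gt hj₁

theorem Nat.Prime.card_divisors_mul_of_not_dvd {p k : ℕ} (hp : p.Prime) (h : ¬ p ∣ k) :
    (p * k).divisors.card = 2 * k.divisors.card := by
  rw [Nat.Coprime.card_divisors_mul ((Nat.Prime.coprime_iff_not_dvd hp).2 h), hp.divisors,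
    Finset.card_pair hp.one_lt.ne]

/-- Lemma 2, single-step form: if `n` is an HCN, `p ‖ n`, `q > p` is a prime not
dividing `n`, `n₁` is the smallest HCN greater than `n`, and `n·q/p < n₁`, then
`n·q/p` is largely composite. -/
theorem lcn_of_single_swap (n p q n₁ : ℕ)
    (hn : HighlyComposite n)
    (hp : p.Prime) (hpn : p ∣ n) (hp2 : ¬ p ^ 2 ∣ n)
    (hq : q.Prime) (hqp : p < q) (hqn : ¬ q ∣ n)
    (hn₁ : HighlyComposite n₁) (hnn₁ : n < n₁)
    (hmin : ∀ m : ℕ, HighlyComposite m → n < m → n₁ ≤ m)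
    (hlt : n * q / p < n₁) :
    LargelyComposite (n * q / p) := by
  obtain ⟨k, rfl⟩ := hpn
  have hpk : ¬ p ∣ k := fun h => hp2 (by rw [pow_two]; exact mul_dvd_mul_left p h)
  have hqk : ¬ q ∣ k := fun h => hqn (h.mul_left p)
  have hk : 0 < k := Nat.pos_of_mul_pos_left hn.1
  have hm : p * k * q / p = q * k := by
    rw [mul_assoc, Nat.mul_div_cancel_left _ hp.pos, mul_comm]
  rw [hm] at hlt ⊢
  refine ⟨Nat.mul_pos hq.pos hk, fun j hj hjm => ?_⟩
  rw [hq.card_divisors_mul_of_not_dvd hqk, ← hp.card_divisors_mul_of_not_dvd hpk]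
  exact hn.card_divisors_le_of_lt_next hmin hj (hjm.trans hlt)
end

section
/- (Lemma 3, single-step form.) Let N be a largely composite number, let P be the greatest prime divisor of N with P ∣ N and P² ∤ N, and let q be a prime with q < P and q ∤ N. Then the integer N·q/P is a largely composite number. -/
theorem Nat.Prime.card_divisors_mul {p k : ℕ} (hp : p.Prime) (hpk : ¬ p ∣ k) :
    (k * p).divisors.card = k.divisors.card * 2 := by
  rw [((hp.coprime_iff_not_dvd.mpr hpk).symm).card_divisors_mul, hp.divisors,
    Finset.card_pair hp.one_lt.ne]

/-- Lemma 3, single-step form: if `N` is an LCN whose greatest prime divisor `P`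
satisfies `P ‖ N`, and `q < P` is a prime not dividing `N`, then `N·q/P` is
largely composite. -/
theorem lcn_single_step_down (N P q : ℕ)
    (hN : LargelyComposite N)
    (hP : P.Prime) (hPN : P ∣ N) (hP2 : ¬ P ^ 2 ∣ N)
    (hgreatest : ∀ r : ℕ, r.Prime → r ∣ N → r ≤ P)
    (hq : q.Prime) (hqP : q < P) (hqN : ¬ q ∣ N) :
    LargelyComposite (N * q / P) := by
  obtain ⟨k, rfl⟩ := hPN
  have hPk : ¬ P ∣ k := fun h => hP2 (by rw [pow_two]; exact mul_dvd_mul_left P h)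
  have hqk : ¬ q ∣ k := fun h => hqN (h.mul_left P)
  have hk : 0 < k := Nat.pos_of_mul_pos_left hN.1
  have hcard : (k * q).divisors.card = (P * k).divisors.card := by
    rw [mul_comm P k, hq.card_divisors_mul hqk, hP.card_divisors_mul hPk]
  rw [mul_assoc, Nat.mul_div_cancel_left _ hP.pos]
  refine ⟨Nat.mul_pos hk hq.pos, fun m hm hlt => hcard ▸ hN.2 m hm (hlt.trans ?_)⟩
  rw [mul_comm P k]
  exact Nat.mul_lt_mul_of_pos_left hqP hk
end

section
/- (Lemma 3.) Let N be a largely composite number, let P = p_{k+r} (the (k+r)-th prime) be the greatest prime divisor of N with P² ∤ N, and suppose the second greatest prime divisor of N is p_{k-1}, so that the r primes p_k, p_{k+1}, ..., p_{k+r-1} do not divide N. Then each of the numbers N·p_{k+r-1}/p_{k+r}, N·p_{k+r-2}/p_{k+r}, ..., N·p_k/p_{k+r} is a largely composite number. -/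
/-- The `j`-th prime number (1-indexed: `nthPrime 1 = 2`, `nthPrime 2 = 3`, ...). -/
noncomputable def nthPrime (j : ℕ) : ℕ := Nat.nth Nat.Prime (j - 1)

theorem card_divisors_mul_prime {m q : ℕ} (hq : q.Prime) (h : ¬ q ∣ m) :
    (m * q).divisors.card = m.divisors.card * 2 := by
  rw [Nat.Coprime.card_divisors_mul ((hq.coprime_iff_not_dvd.2 h).symm), hq.divisors,
    Finset.card_pair hq.one_lt.ne]

/-- Replacing a prime that divides a largely composite number exactly once by a smaller prime
not dividing it gives a largely composite number. -/
theorem LargelyComposite.mul_prime_div_prime {N p q : ℕ} (hN : LargelyComposite N)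
    (hp : p.Prime) (hq : q.Prime) (hqp : q < p) (hpN : p ∣ N) (hp2 : ¬ p ^ 2 ∣ N)
    (hqN : ¬ q ∣ N) : LargelyComposite (N * q / p) := by
  obtain ⟨M, rfl⟩ := hpN
  obtain ⟨hpos, hmax⟩ := hN
  have hM : 0 < M := Nat.pos_of_mul_pos_left hpos
  rw [mul_assoc, Nat.mul_div_cancel_left _ hp.pos]
  have hpM : ¬ p ∣ M := fun h => hp2 (by rw [sq]; exact mul_dvd_mul_left p h)
  have hqM : ¬ q ∣ M := fun h => hqN (h.mul_left p)
  refine ⟨Nat.mul_pos hM hq.pos, fun m hm hlt => ?_⟩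
  rw [card_divisors_mul_prime hq hqM, ← card_divisors_mul_prime hp hpM, mul_comm M p]
  refine hmax m hm (hlt.trans ?_)
  rw [mul_comm p M]
  exact Nat.mul_lt_mul_of_pos_left hqp hM

theorem nthPrime_prime (j : ℕ) : (nthPrime j).Prime := Nat.prime_nth_prime _

theorem nthPrime_lt_nthPrime {i j : ℕ} (hi : 1 ≤ i) (hij : i < j) :
    nthPrime i < nthPrime j :=
  Nat.nth_strictMono Nat.infinite_setOfPred_prime (by omega)

/-- Lemma 3: if `N` is an LCN whose greatest prime divisor is `p_{k+r}` with
`p_{k+r}² ∤ N`, and whose second greatest prime divisor is `p_{k-1}` (so that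
`p_k, ..., p_{k+r-1}` do not divide `N`), then each of
`N·p_{k+r-1}/p_{k+r}, ..., N·p_k/p_{k+r}` is largely composite. -/
theorem lcn_chain_down (N k r : ℕ)
    (hN : LargelyComposite N) (hk : 2 ≤ k) (hr : 1 ≤ r)
    (hPN : nthPrime (k + r) ∣ N) (hP2 : ¬ (nthPrime (k + r)) ^ 2 ∣ N)
    (hgreatest : ∀ q : ℕ, q.Prime → q ∣ N → q ≤ nthPrime (k + r))
    (hsecond : nthPrime (k - 1) ∣ N)
    (hsecond' : ∀ q : ℕ, q.Prime → q ∣ N → q < nthPrime (k + r) →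
      q ≤ nthPrime (k - 1))
    (hgap : ∀ j : ℕ, k ≤ j → j ≤ k + r - 1 → ¬ nthPrime j ∣ N) :
    ∀ j : ℕ, k ≤ j → j ≤ k + r - 1 →
      LargelyComposite (N * nthPrime j / nthPrime (k + r)) := by
  intro j hkj hj
  exact hN.mul_prime_div_prime (nthPrime_prime _) (nthPrime_prime _)
    (nthPrime_lt_nthPrime (by omega) (by omega)) hPN hP2 (hgap j hkj hj)
end

section
/- (Lemma 1, Erdős.) There exist real constants c₁ > 0 and c₂ > 0 and a threshold N₀ such that for every highly composite number n ≥ N₀, the greatest prime divisor P of n satisfies c₁ · log n < P < c₂ · log n. -/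
namespace HighlyComposite

variable {n p q : ℕ}

/-- All primes below the greatest prime divisor of a highly composite number divide it. -/
theorem dvd_of_prime_le (hn : HighlyComposite n) (hp : p.Prime) (hpn : p ∣ n) (hq : q.Prime)
    (hqp : q ≤ p) : q ∣ n := by
  by_contra hqn
  have hlt : q < p := lt_of_le_of_ne hqp (by rintro rfl; exact hqn hpn)
  obtain ⟨a, m, hpm, rfl⟩ := Nat.exists_eq_pow_mul_and_not_dvd hn.1.ne' p hp.ne_one
  have hm : 0 < m := Nat.pos_of_ne_zero (by rintro rfl; simp at hpm)
  have ha : a ≠ 0 := by rintro rfl; simp [hpm] at hpn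
  have hqm : ¬ q ∣ m := fun h => hqn (h.mul_left _)
  have h := hn.2 (q ^ a * m) (Nat.mul_pos (pow_pos hq.pos a) hm)
    (Nat.mul_lt_mul_of_pos_right (Nat.pow_lt_pow_left hlt ha) hm)
  rw [((hq.coprime_iff_not_dvd.2 hqm).pow_left a).card_divisors_mul,
    ((hp.coprime_iff_not_dvd.2 hpm).pow_left a).card_divisors_mul] at h
  simp [Nat.divisors_prime_pow, hp, hq] at h

theorem primorial_dvd (hn : HighlyComposite n) (hp : p.Prime) (hpn : p ∣ n) :
    primorial p ∣ n := by
  rw [primorial_eq_prod_primesLE]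
  refine Finset.prod_primes_dvd n (fun q hq => (Nat.prime_of_mem_primesLE hq).prime) fun q hq => ?_
  exact hn.dvd_of_prime_le hp hpn (Nat.prime_of_mem_primesLE hq) (Nat.le_of_mem_primesLE hq)

/-- If a prime `q` does not divide a highly composite number, then the exponent of each prime `p`
in it is at most `2 * ⌊log_p q⌋`. -/
theorem factorization_le (hn : HighlyComposite n) (hp : p.Prime) (hq : q.Prime) (hqn : ¬ q ∣ n) :
    n.factorization p ≤ 2 * Nat.log p q := by
  by_cases hpq : p = q
  · subst hpq
    simp [Nat.factorization_eq_zero_of_not_dvd hqn]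
  obtain ⟨a, m, hpm, rfl⟩ := Nat.exists_eq_pow_mul_and_not_dvd hn.1.ne' p hp.ne_one
  have hm : 0 < m := Nat.pos_of_ne_zero (by rintro rfl; simp at hpm)
  have hfac : (p ^ a * m).factorization p = a := by
    rw [Nat.factorization_mul (pow_pos hp.pos a).ne' hm.ne']
    simp [hp, Nat.factorization_eq_zero_of_not_dvd hpm]
  rw [hfac]
  by_contra! hlt
  set l := Nat.log p q with hl
  have hlog : q < p ^ (l + 1) := Nat.lt_pow_succ_log_self hp.one_lt q
  have hl1 : l + 1 ≤ a := by omega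
  obtain ⟨c, rfl⟩ := Nat.exists_eq_add_of_le hl1
  have hqm : ¬ q ∣ m := fun h => hqn (h.mul_left _)
  have hpqm : ¬ p ∣ q * m := by
    rw [hp.dvd_mul, Nat.prime_dvd_prime_iff_eq hp hq]
    tauto
  have h := hn.2 (p ^ c * (q * m)) (by have := hp.pos; have := hq.pos; positivity) (by
    rw [pow_add, mul_comm (p ^ (l + 1)), mul_assoc]
    have := hp.pos
    gcongr)
  rw [((hp.coprime_iff_not_dvd.2 hpqm).pow_left c).card_divisors_mul,
    (hq.coprime_iff_not_dvd.2 hqm).card_divisors_mul,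
    ((hp.coprime_iff_not_dvd.2 hpm).pow_left _).card_divisors_mul, ← mul_assoc] at h
  have h' := lt_of_mul_lt_mul_right h (Nat.zero_le _)
  rw [Nat.divisors_prime_pow hp, Nat.divisors_prime_pow hp, hq.divisors] at h'
  simp [Finset.card_pair hq.one_lt.ne] at h'
  omega

theorem log_le_two_mul_psi (hn : HighlyComposite n) (hq : q.Prime) (hqn : ¬ q ∣ n) :
    Real.log n ≤ 2 * Chebyshev.psi q := by
  have hdvd : n ∣ Nat.lcmUpto q ^ 2 := by
    rw [← Nat.factorization_prime_le_iff_dvd hn.1.ne' (pow_ne_zero 2 (Nat.lcmUpto_ne_zero q))]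
    intro p hp
    simpa [Nat.factorization_lcmUpto q hp] using hn.factorization_le hp hq hqn
  rw [Chebyshev.psi_eq_log_lcmUpto]
  have hle := Nat.le_of_dvd (pow_pos (Nat.lcmUpto_pos q) 2) hdvd
  calc Real.log n ≤ Real.log ((Nat.lcmUpto q : ℝ) ^ 2) :=
        Real.log_le_log (mod_cast hn.1) (mod_cast hle)
    _ = 2 * Real.log (Nat.lcmUpto q) := by simp

end HighlyComposite

theorem exists_forall_le_two_mul_theta :
    ∃ X : ℝ, ∀ n : ℕ, X ≤ n → (n : ℝ) ≤ 2 * Chebyshev.theta n := by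
  obtain ⟨C, hC⟩ := Chebyshev.psi_sub_theta_le_mul_sqrt
  refine ⟨(10 * (|C| + 2)) ^ 2, fun n hn => ?_⟩
  have hs : 10 * (|C| + 2) ≤ √n := Real.le_sqrt_of_sq_le hn
  have hs0 : 0 ≤ √(n : ℝ) := Real.sqrt_nonneg _
  have hss : √(n : ℝ) * √n = n := Real.mul_self_sqrt (Nat.cast_nonneg n)
  have hlog : Real.log (n + 1) ≤ 2 * √n := by
    calc Real.log (n + 1) ≤ Real.log ((√n + 1) ^ 2) :=
          Real.log_le_log (by positivity) (by nlinarith)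
      _ = 2 * Real.log (√n + 1) := by simp
      _ ≤ 2 * √n := by linarith [Real.log_le_sub_one_of_pos (show 0 < √(n : ℝ) + 1 by positivity)]
  have habs : C * √n ≤ |C| * √n := mul_le_mul_of_nonneg_right (le_abs_self C) hs0
  have hn0 : (0 : ℝ) ≤ n := Nat.cast_nonneg n
  nlinarith [Chebyshev.psi_ge n, hC n, Real.log_two_gt_d9, mul_le_mul_of_nonneg_right hs hs0]

/-- Lemma 1 (Erdős): the greatest prime divisor `P` of a large highly composite
number `n` satisfies `c₁·log n < P < c₂·log n`. -/
theorem erdos_greatest_prime_bounds :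
    ∃ c₁ c₂ : ℝ, 0 < c₁ ∧ 0 < c₂ ∧ ∃ N₀ : ℕ, ∀ n : ℕ, N₀ ≤ n →
      HighlyComposite n →
      ∀ P : ℕ, P.Prime → P ∣ n → (∀ r : ℕ, r.Prime → r ∣ n → r ≤ P) →
        c₁ * Real.log n < (P : ℝ) ∧ (P : ℝ) < c₂ * Real.log n := by
  obtain ⟨X, hX⟩ := exists_forall_le_two_mul_theta
  have hK : 0 < 4 * (Real.log 4 + 4) + 1 := by positivity
  refine ⟨(4 * (Real.log 4 + 4) + 1)⁻¹, 3, inv_pos.2 hK, by norm_num, ⌈Real.exp (max X 1)⌉₊,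
    fun n hn hnc P hP hPn hmax => ⟨?_, ?_⟩⟩
  · obtain ⟨q, hq, hPq, hq2⟩ := Nat.exists_prime_lt_and_le_two_mul P hP.ne_zero
    have hlog := hnc.log_le_two_mul_psi hq fun h => (hmax q hq h).not_gt hPq
    have hpsi := Chebyshev.psi_le_const_mul_self (Nat.cast_nonneg (α := ℝ) q)
    have hq2' : (q : ℝ) ≤ 2 * P := mod_cast hq2
    have hP0 : (0 : ℝ) < P := mod_cast hP.pos
    have hmul := mul_le_mul_of_nonneg_left hq2' (show 0 ≤ Real.log 4 + 4 by positivity)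
    rw [inv_mul_lt_iff₀ hK]
    linarith
  · have hlogn : max X 1 ≤ Real.log n :=
      (Real.le_log_iff_exp_le (mod_cast hnc.1)).2 ((Nat.le_ceil _).trans (mod_cast hn))
    have hX' := (le_max_left _ _).trans hlogn
    have h1 := (le_max_right _ _).trans hlogn
    rcases le_total X P with hXP | hPX
    · have htheta : Chebyshev.theta P ≤ Real.log n := by
        rw [Chebyshev.theta_eq_log_primorial, Nat.floor_natCast]
        exact Real.log_le_log (mod_cast primorial_pos P)
          (mod_cast Nat.le_of_dvd hnc.1 (hnc.primorial_dvd hP hPn))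
      linarith [hX P hXP]
    · linarith
end

section
/- There exists a threshold N₀ such that for every highly composite number n ≥ N₀, the greatest prime divisor P of n divides n exactly once, i.e., P ∣ n and P² ∤ n. -/
theorem card_divisors_prime_pow_mul {p k : ℕ} (hp : p.Prime) (hk : ¬ p ∣ k) (a : ℕ) :
    (p ^ a * k).divisors.card = (a + 1) * k.divisors.card := by
  rw [Nat.Coprime.card_divisors_mul (((Nat.Prime.coprime_iff_not_dvd hp).2 hk).pow_left a),
    Nat.divisors_prime_pow hp, Finset.card_map, Finset.card_range]

/-- If all prime divisors of a highly composite number are less than `11`, then their exponents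
are at most `6`. -/
theorem HighlyComposite.factorization_le_six {n : ℕ} (h : HighlyComposite n)
    (hn : ∀ r : ℕ, r.Prime → r ∣ n → r < 11) (r : ℕ) : n.factorization r ≤ 6 := by
  obtain ⟨hpos, h⟩ := h
  by_contra! ha
  have hr : r.Prime := by
    by_contra hr
    simp [Nat.factorization_eq_zero_of_not_prime n hr] at ha
  obtain ⟨a, k, hk, rfl⟩ := Nat.exists_eq_pow_mul_and_not_dvd hpos.ne' r hr.ne_one
  have h11 : Nat.Prime 11 := by norm_num
  have hk0 : 0 < k := Nat.pos_of_mul_pos_left hpos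
  have hk11 : ¬ 11 ∣ k := fun hd => lt_irrefl _ (hn 11 h11 (hd.mul_left _))
  have hfac : (r ^ a * k).factorization r = a := by
    rw [Nat.factorization_mul (pow_pos hr.pos a).ne' hk0.ne']
    simp [hr.factorization, Nat.factorization_eq_zero_of_not_dvd hk]
  rw [hfac] at ha
  obtain ⟨c, rfl⟩ : ∃ c, a = c + 4 := ⟨a - 4, by omega⟩
  have hr11 : r < 11 := hn r hr ((dvd_pow_self r (by omega)).mul_right k)
  have hrk : ¬ r ∣ 11 ^ 1 * k := by
    rw [pow_one, hr.dvd_mul, Nat.prime_dvd_prime_iff_eq hr h11]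
    rintro (rfl | hd)
    exacts [lt_irrefl _ hr11, hk hd]
  have hlt : r ^ c * (11 ^ 1 * k) < r ^ (c + 4) * k := by
    have h16 : 2 ^ 4 ≤ r ^ 4 := Nat.pow_le_pow_left hr.two_le 4
    have hc : 0 < r ^ c * k := Nat.mul_pos (pow_pos hr.pos c) hk0
    calc r ^ c * (11 ^ 1 * k) = r ^ c * k * 11 := by ring
      _ < r ^ c * k * r ^ 4 := Nat.mul_lt_mul_of_pos_left (by omega) hc
      _ = r ^ (c + 4) * k := by ring
  have hcard := h _ (Nat.mul_pos (pow_pos hr.pos c) (by omega)) hlt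
  rw [card_divisors_prime_pow_mul hr hrk, card_divisors_prime_pow_mul h11 hk11,
    card_divisors_prime_pow_mul hr hk] at hcard
  nlinarith [Nat.zero_le k.divisors.card]

theorem HighlyComposite.le_of_prime_dvd_lt_eleven {n : ℕ} (h : HighlyComposite n)
    (hn : ∀ r : ℕ, r.Prime → r ∣ n → r < 11) : n ≤ 210 ^ 6 := by
  refine Nat.le_of_dvd (by norm_num) ?_
  rw [← Nat.factorization_le_iff_dvd h.1.ne' (by norm_num)]
  intro r
  by_cases hr : r.Prime ∧ r ∣ n
  · have hdvd : r ∣ 210 := by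
      have hlt := hn r hr.1 hr.2
      have hp := hr.1
      interval_cases r <;> revert hp <;> norm_num
    have hpos : 1 ≤ Nat.factorization 210 r :=
      (hr.1.dvd_iff_one_le_factorization (by norm_num)).1 hdvd
    have hle := h.factorization_le_six hn r
    rw [Nat.factorization_pow, Finsupp.smul_apply, smul_eq_mul]
    omega
  · have h0 : n.factorization r = 0 := by
      rw [Nat.factorization_eq_zero_iff]
      tauto
    omega

/-- A highly composite number whose greatest prime divisor is at least `11` is not divisible by
the square of that prime. -/
theorem HighlyComposite.not_sq_dvd {n P : ℕ} (h : HighlyComposite n) (hP : P.Prime)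
    (hP11 : 11 ≤ P) (hmax : ∀ r : ℕ, r.Prime → r ∣ n → r ≤ P) : ¬ P ^ 2 ∣ n := by
  obtain ⟨hpos, h⟩ := h
  intro hsq
  obtain ⟨b, l, hl, rfl⟩ := Nat.exists_eq_pow_mul_and_not_dvd hpos.ne' P hP.ne_one
  have hl0 : 0 < l := Nat.pos_of_mul_pos_left hpos
  have hb : 2 ≤ b := by
    by_contra! hb
    refine hl ((Nat.mul_dvd_mul_iff_left (pow_pos hP.pos b)).1 ?_)
    rw [← pow_succ]
    exact (pow_dvd_pow P (by omega)).trans hsq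
  obtain ⟨e, rfl⟩ : ∃ e, b = e + 1 := ⟨b - 1, by omega⟩
  have h2 := Nat.prime_two
  obtain ⟨a, k, hk, rfl⟩ := Nat.exists_eq_pow_mul_and_not_dvd hl0.ne' 2 (by norm_num)
  have hk0 : 0 < k := Nat.pos_of_mul_pos_left hl0
  have hPk : ¬ P ∣ k := fun hd => hl (hd.mul_left _)
  have hP2 : ∀ c m, ¬ P ∣ m → ¬ P ∣ 2 ^ c * m := by
    intro c m hm hd
    rcases hP.dvd_mul.1 hd with hd | hd
    · have := Nat.le_of_dvd (by norm_num) (hP.dvd_of_dvd_pow hd)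
      omega
    · exact hm hd
  have hek : 0 < P ^ e * k := Nat.mul_pos (pow_pos hP.pos e) hk0
  have hd0 : 0 < k.divisors.card := Finset.card_pos.2 (Nat.nonempty_divisors.2 hk0.ne')
  rcases le_or_gt a 2 with ha | ha
  · have hlt : P ^ e * (2 ^ (a + 3) * k) < P ^ (e + 1) * (2 ^ a * k) := by
      calc P ^ e * (2 ^ (a + 3) * k) = P ^ e * k * 2 ^ a * 8 := by ring
        _ < P ^ e * k * 2 ^ a * P :=
          Nat.mul_lt_mul_of_pos_left (by omega) (Nat.mul_pos hek (by positivity))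
        _ = P ^ (e + 1) * (2 ^ a * k) := by ring
    have hcard := h _ (Nat.mul_pos (pow_pos hP.pos e) (by positivity)) hlt
    rw [card_divisors_prime_pow_mul hP (hP2 _ _ hPk), card_divisors_prime_pow_mul hP (hP2 _ _ hPk),
      card_divisors_prime_pow_mul h2 hk, card_divisors_prime_pow_mul h2 hk, ← mul_assoc,
      ← mul_assoc] at hcard
    have hcard' := lt_of_mul_lt_mul_right hcard (Nat.zero_le _)
    interval_cases a <;> omega
  · obtain ⟨c, rfl⟩ : ∃ c, a = c + 1 := ⟨a - 1, by omega⟩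
    obtain ⟨Q, hQ, hPQ, hQP⟩ := Nat.exists_prime_lt_and_le_two_mul P hP.ne_zero
    have hQlt : Q < 2 * P := by
      refine lt_of_le_of_ne hQP ?_
      rintro rfl
      exact Nat.not_prime_mul (by norm_num) hP.ne_one hQ
    have hQk : ¬ Q ∣ k := fun hd => by
      have := hmax Q hQ ((hd.mul_left _).mul_left _)
      omega
    have hPQk : ¬ P ∣ Q ^ 1 * k := by
      rw [pow_one, hP.dvd_mul, Nat.prime_dvd_prime_iff_eq hP hQ]
      rintro (rfl | hd)
      exacts [lt_irrefl _ hPQ, hPk hd]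
    have h2Qk : ¬ 2 ∣ Q ^ 1 * k := by
      rw [pow_one, h2.dvd_mul, Nat.prime_dvd_prime_iff_eq h2 hQ]
      rintro (rfl | hd)
      exacts [by omega, hk hd]
    have hlt : P ^ e * (2 ^ c * (Q ^ 1 * k)) < P ^ (e + 1) * (2 ^ (c + 1) * k) := by
      calc P ^ e * (2 ^ c * (Q ^ 1 * k)) = P ^ e * k * 2 ^ c * Q := by ring
        _ < P ^ e * k * 2 ^ c * (2 * P) :=
          Nat.mul_lt_mul_of_pos_left hQlt (Nat.mul_pos hek (by positivity))
        _ = P ^ (e + 1) * (2 ^ (c + 1) * k) := by ring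
    have hQ0 := hQ.pos
    have hP0 := hP.pos
    have hcard := h _ (by positivity) hlt
    rw [card_divisors_prime_pow_mul hP (hP2 _ _ hPQk), card_divisors_prime_pow_mul hP (hP2 _ _ hPk),
      card_divisors_prime_pow_mul h2 h2Qk, card_divisors_prime_pow_mul h2 hk,
      card_divisors_prime_pow_mul hQ hQk, ← mul_assoc, ← mul_assoc, ← mul_assoc] at hcard
    have hcard' := lt_of_mul_lt_mul_right hcard (Nat.zero_le _)
    obtain ⟨x, rfl⟩ : ∃ x, e = x + 1 := ⟨e - 1, by omega⟩
    obtain ⟨y, rfl⟩ : ∃ y, c = y + 2 := ⟨c - 2, by omega⟩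
    nlinarith [Nat.zero_le (x * y)]

/-- For every large highly composite number `n`, the greatest prime divisor `P`
of `n` divides `n` exactly once: `P ∣ n` and `P² ∤ n`. -/
theorem hcn_greatest_prime_exactly_once :
    ∃ N₀ : ℕ, ∀ n : ℕ, N₀ ≤ n → HighlyComposite n →
      ∀ P : ℕ, P.Prime → P ∣ n → (∀ r : ℕ, r.Prime → r ∣ n → r ≤ P) →
        P ∣ n ∧ ¬ P ^ 2 ∣ n := by
  refine ⟨210 ^ 6 + 1, fun n hn h P hP hPn hmax => ⟨hPn, ?_⟩⟩
  rcases lt_or_ge P 11 with hlt | hge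
  · have := h.le_of_prime_dvd_lt_eleven fun r hr hrn => (hmax r hr hrn).trans_lt hlt
    omega
  · exact h.not_sq_dvd hP hge hmax
end

section
/- Suppose there exist a constant c > 0 and a threshold N₀ such that for every highly composite number n ≥ N₀ there exists a highly composite number n₁ with n < n₁ < n + n·(log n)^{-c}. Then for every c' with 0 < c' < c there exists x₀ such that for all real x ≥ x₀, the number of highly composite numbers not exceeding x is greater than (log x)^{1+c'}. -/
/-- There are arbitrarily large highly composite numbers. -/
theorem exists_lt_highlyComposite (M : ℕ) : ∃ n, M < n ∧ HighlyComposite n := by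
  classical
  have hex : ∃ n, 0 < n ∧ ∀ m, 0 < m → m ≤ M → m.divisors.card < n.divisors.card := by
    refine ⟨2 ^ M, by positivity, fun m _ hmM => ?_⟩
    rw [Nat.divisors_prime_pow Nat.prime_two, Finset.card_map, Finset.card_range]
    have := Nat.card_divisors_le_self m
    omega
  obtain ⟨hpos, hlt⟩ := Nat.find_spec hex
  refine ⟨Nat.find hex, ?_, hpos, fun m hm hmn => ?_⟩
  · by_contra! h
    exact lt_irrefl _ (hlt _ hpos h)
  · have hmin := Nat.find_min hex hmn
    push Not at hmin
    obtain ⟨k, hk, hkM, hle⟩ := hmin hm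
    exact hle.trans_lt (hlt k hk hkM)

/-- The chord bound for the convex function `u ↦ (1 + u) ^ p` on `[0, 1]`. -/
theorem one_add_rpow_le_one_add_mul {p u : ℝ} (hp : 1 ≤ p) (hu₀ : 0 ≤ u) (hu₁ : u ≤ 1) :
    (1 + u) ^ p ≤ 1 + (2 ^ p - 1) * u := by
  have h := (convexOn_rpow hp).2 (x := 1) (y := 2) (by simp) (by simp)
    (sub_nonneg.2 hu₁) hu₀ (by ring)
  simp only [smul_eq_mul, Real.one_rpow] at h
  calc (1 + u) ^ p = ((1 - u) * 1 + u * 2) ^ p := by ring_nf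
    _ ≤ (1 - u) * 1 + u * 2 ^ p := h
    _ = 1 + (2 ^ p - 1) * u := by ring

/-- A step of relative size at most `(log a)⁻ᶜ` raises `(log a) ^ (1 + c)` by at most a constant. -/
theorem log_rpow_le_add_of_lt {a b c : ℝ} (hc : 0 < c) (ha : 0 < a) (hab : a < b)
    (hlog : 1 ≤ Real.log a) (hb : b < a + a * Real.log a ^ (-c)) :
    Real.log b ^ (1 + c) ≤ Real.log a ^ (1 + c) + (2 ^ (1 + c) - 1) := by
  set L := Real.log a with hL
  have hL₀ : 0 < L := by linarith
  set u := L ^ (-(1 + c)) with hu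
  have hu₀ : 0 < u := Real.rpow_pos_of_pos hL₀ _
  have hu₁ : u ≤ 1 := Real.rpow_le_one_of_one_le_of_nonpos hlog (by linarith)
  have hLu : L * u = L ^ (-c) := by
    rw [hu, ← Real.rpow_one_add' hL₀.le (by linarith)]
    ring_nf
  have hLpu : L ^ (1 + c) * u = 1 := by
    rw [hu, ← Real.rpow_add hL₀, add_neg_cancel, Real.rpow_zero]
  have hstep : Real.log b ≤ L * (1 + u) := by
    have h1 : 0 < 1 + L ^ (-c) := by positivity
    calc Real.log b ≤ Real.log (a * (1 + L ^ (-c))) :=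
          Real.log_le_log (ha.trans hab) (by linarith)
      _ = L + Real.log (1 + L ^ (-c)) := Real.log_mul ha.ne' h1.ne'
      _ ≤ L + L ^ (-c) := by linarith [Real.log_le_sub_one_of_pos h1]
      _ = L * (1 + u) := by rw [← hLu]; ring
  have hlogb : 0 ≤ Real.log b := hL₀.le.trans (Real.log_le_log ha hab.le)
  calc Real.log b ^ (1 + c) ≤ (L * (1 + u)) ^ (1 + c) :=
        Real.rpow_le_rpow hlogb hstep (by linarith)
    _ = L ^ (1 + c) * (1 + u) ^ (1 + c) := Real.mul_rpow hL₀.le (by positivity)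
    _ ≤ L ^ (1 + c) * (1 + (2 ^ (1 + c) - 1) * u) := by
        gcongr
        exact one_add_rpow_le_one_add_mul (by linarith) hu₀.le hu₁
    _ = L ^ (1 + c) + (2 ^ (1 + c) - 1) * (L ^ (1 + c) * u) := by ring
    _ = L ^ (1 + c) + (2 ^ (1 + c) - 1) := by rw [hLpu, mul_one]

/-- Under the gap bound, some strictly increasing sequence of highly composite numbers has
`(log a k) ^ (1 + c)` growing at most linearly. -/
theorem exists_strictMono_highlyComposite (c : ℝ) (hc : 0 < c) (N₀ : ℕ)
    (hgap : ∀ n : ℕ, N₀ ≤ n → HighlyComposite n →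
      ∃ n₁ : ℕ, HighlyComposite n₁ ∧ n < n₁ ∧
        (n₁ : ℝ) < (n : ℝ) + (n : ℝ) * Real.log n ^ (-c)) :
    ∃ (a : ℕ → ℕ) (A : ℝ), StrictMono a ∧ 0 ≤ A ∧ (∀ k, HighlyComposite (a k)) ∧
      ∀ k, Real.log (a k) ^ (1 + c) ≤ A + (2 ^ (1 + c) - 1) * k := by
  obtain ⟨n₀, hn₀, hn₀H⟩ := exists_lt_highlyComposite (max N₀ 3)
  choose! f hfH hflt hfgap using hgap
  have hspec : ∀ k, max N₀ 3 < f^[k] n₀ ∧ HighlyComposite (f^[k] n₀) := by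
    intro k
    induction k with
    | zero => exact ⟨hn₀, hn₀H⟩
    | succ k ih =>
      rw [Function.iterate_succ_apply']
      have hN : N₀ ≤ f^[k] n₀ := (le_max_left _ _).trans ih.1.le
      exact ⟨ih.1.trans (hflt _ hN ih.2), hfH _ hN ih.2⟩
  have hN : ∀ k, N₀ ≤ f^[k] n₀ := fun k => (le_max_left _ _).trans (hspec k).1.le
  refine ⟨fun k => f^[k] n₀, Real.log n₀ ^ (1 + c), strictMono_nat_of_lt_succ fun k => ?_,
    Real.rpow_nonneg (Real.log_natCast_nonneg _) _, fun k => (hspec k).2, fun k => ?_⟩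
  · rw [Function.iterate_succ_apply']
    exact hflt _ (hN k) (hspec k).2
  · induction k with
    | zero => simp
    | succ k ih =>
      simp only [Function.iterate_succ_apply'] at ih ⊢
      have h3 : (3 : ℝ) ≤ (f^[k] n₀ : ℕ) := by
        exact_mod_cast (le_max_right N₀ 3).trans (hspec k).1.le
      have hlog : 1 ≤ Real.log (f^[k] n₀ : ℕ) := by
        rw [Real.le_log_iff_exp_le (by linarith)]
        linarith [Real.exp_one_lt_d9]
      have := log_rpow_le_add_of_lt hc (by linarith)
        (Nat.cast_lt.2 (hflt _ (hN k) (hspec k).2)) hlog (hfgap _ (hN k) (hspec k).2)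
      push_cast
      linarith

/-- The gap bound (1) implies that for every `c' < c` the number of HCNs up to
`x` eventually exceeds `(log x)^{1+c'}`. -/
theorem hcn_gap_implies_counting (c : ℝ) (hc : 0 < c) (N₀ : ℕ)
    (hgap : ∀ n : ℕ, N₀ ≤ n → HighlyComposite n →
      ∃ n₁ : ℕ, HighlyComposite n₁ ∧ n < n₁ ∧
        (n₁ : ℝ) < (n : ℝ) + (n : ℝ) * Real.log n ^ (-c)) :
    ∀ c' : ℝ, 0 < c' → c' < c → ∃ x₀ : ℝ, ∀ x : ℝ, x₀ ≤ x →
      (({n : ℕ | HighlyComposite n ∧ (n : ℝ) ≤ x}.ncard : ℝ)) >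
        Real.log x ^ (1 + c') := by
  intro c' hc' hcc'
  obtain ⟨a, A, ha, hA, haH, hbound⟩ := exists_strictMono_highlyComposite c hc N₀ hgap
  set C : ℝ := 2 ^ (1 + c) - 1
  have hC : 0 < C := sub_pos.2 (Real.one_lt_rpow one_lt_two (by linarith))
  have hev : ∀ᶠ x in Filter.atTop, 1 ≤ Real.log x ∧ A + C ≤ Real.log x ^ (c - c') :=
    Real.tendsto_log_atTop.eventually ((Filter.eventually_ge_atTop 1).and
      ((tendsto_rpow_atTop (sub_pos.2 hcc')).eventually_ge_atTop (A + C)))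
  obtain ⟨x₀, hx₀⟩ := Filter.eventually_atTop.1 (hev.and (Filter.eventually_gt_atTop 0))
  refine ⟨x₀, fun x hx => ?_⟩
  obtain ⟨⟨hlog, hlarge⟩, hxpos⟩ := hx₀ x hx
  set y := Real.log x with hy
  have hy₀ : 0 < y := by linarith
  have hy₁ : 1 ≤ y ^ (1 + c') := Real.one_le_rpow hlog (by linarith)
  have hmain : A + C * y ^ (1 + c') ≤ y ^ (1 + c) := by
    calc A + C * y ^ (1 + c') ≤ (A + C) * y ^ (1 + c') := by nlinarith
      _ ≤ y ^ (c - c') * y ^ (1 + c') := by gcongr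
      _ = y ^ (1 + c) := by rw [← Real.rpow_add hy₀]; ring_nf
  set K := ⌊y ^ (1 + c')⌋₊ with hK
  have hle : ∀ k ≤ K, (a k : ℝ) ≤ x := by
    intro k hk
    have hak : (0 : ℝ) < a k := Nat.cast_pos.2 (haH k).1
    have hkK : (k : ℝ) ≤ y ^ (1 + c') := (Nat.le_floor_iff (by positivity)).1 hk
    have hpow : Real.log (a k) ^ (1 + c) ≤ y ^ (1 + c) :=
      (hbound k).trans (hmain.trans' (by gcongr))
    rw [Real.rpow_le_rpow_iff (Real.log_natCast_nonneg _) hy₀.le (by linarith)] at hpow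
    exact (Real.log_le_log_iff hak hxpos).1 hpow
  have hfin : {n : ℕ | HighlyComposite n ∧ (n : ℝ) ≤ x}.Finite :=
    (Set.finite_Iic ⌊x⌋₊).subset fun n hn => Nat.le_floor hn.2
  have hsub : (((Finset.range (K + 1)).image a : Finset ℕ) : Set ℕ) ⊆
      {n : ℕ | HighlyComposite n ∧ (n : ℝ) ≤ x} := by
    intro n hn
    simp only [Finset.coe_image, Set.mem_image, Finset.mem_coe, Finset.mem_range] at hn
    obtain ⟨k, hk, rfl⟩ := hn
    exact ⟨haH k, hle k (Nat.lt_succ_iff.1 hk)⟩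
  have hcard := Set.ncard_le_ncard hsub hfin
  rw [Set.ncard_coe_finset, Finset.card_image_of_injective _ ha.injective,
    Finset.card_range] at hcard
  calc y ^ (1 + c') < K + 1 := Nat.lt_floor_add_one _
    _ ≤ _ := by exact_mod_cast hcard
end

section
/- For every ε with 0 < ε < 1/4 there exists K such that for all integers k ≥ K, all integers r with 1 ≤ r ≤ k, and all real t with 4ε ≤ t < 1: if p_{k+r} / p_k < 1 + t/2, then r ≤ k·t, where p_j denotes the j-th prime. -/
open MeasureTheory Filter Topology Set

theorem integral_triangle_mul_cexp (v : ℝ) :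
    ∫ t in (-1 : ℝ)..1, ((1 - |t| : ℝ) : ℂ) * Complex.exp (2 * t * v * Complex.I) =
      (Real.sinc v ^ 2 : ℝ) := by
  have hcont : Continuous fun t : ℝ ↦
      ((1 - |t| : ℝ) : ℂ) * Complex.exp (2 * t * v * Complex.I) := by fun_prop
  rw [← intervalIntegral.integral_add_adjacent_intervals (b := 0)
    (hcont.intervalIntegrable _ _) (hcont.intervalIntegrable _ _)]
  have hneg : ∫ t in (-1 : ℝ)..0, ((1 - |t| : ℝ) : ℂ) * Complex.exp (2 * t * v * Complex.I) =
      ∫ t in (-1 : ℝ)..0, (1 + t : ℂ) * Complex.exp (2 * v * Complex.I * t) := by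
    refine intervalIntegral.integral_congr fun t ht ↦ ?_
    rw [uIcc_of_le (by norm_num)] at ht
    simp only [abs_of_nonpos ht.2]
    push_cast
    ring_nf
  have hpos : ∫ t in (0 : ℝ)..1, ((1 - |t| : ℝ) : ℂ) * Complex.exp (2 * t * v * Complex.I) =
      ∫ t in (0 : ℝ)..1, (1 - t : ℂ) * Complex.exp (2 * v * Complex.I * t) := by
    refine intervalIntegral.integral_congr fun t ht ↦ ?_
    rw [uIcc_of_le (by norm_num)] at ht
    simp only [abs_of_nonneg ht.1]
    push_cast
    ring_nf
  rw [hneg, hpos]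
  rcases eq_or_ne v 0 with rfl | hv
  · have h1 : ∫ t in (-1 : ℝ)..0, (1 + t : ℂ) = 1 / 2 := by
      have : ∫ t in (-1 : ℝ)..0, ((1 + t : ℝ) : ℂ) = ((1 / 2 : ℝ) : ℂ) := by
        rw [intervalIntegral.integral_ofReal,
          intervalIntegral.integral_add (by simp) (by simp), integral_id]
        norm_num
      simpa using this
    have h2 : ∫ t in (0 : ℝ)..1, (1 - t : ℂ) = 1 / 2 := by
      have : ∫ t in (0 : ℝ)..1, ((1 - t : ℝ) : ℂ) = ((1 / 2 : ℝ) : ℂ) := by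
        rw [intervalIntegral.integral_ofReal,
          intervalIntegral.integral_sub (by simp) (by simp), integral_id]
        norm_num
      simpa using this
    simp only [Complex.ofReal_zero, mul_zero, zero_mul, Complex.exp_zero, mul_one, h1, h2,
      Real.sinc_zero]
    norm_num
  set a : ℂ := 2 * v * Complex.I with ha
  have ha0 : a ≠ 0 := by simp [ha, hv]
  have hexp (t : ℝ) : HasDerivAt (fun t : ℝ ↦ Complex.exp (a * t)) (Complex.exp (a * t) * a) t := by
    have := ((hasDerivAt_id (t : ℂ)).const_mul a).cexp.comp_ofReal
    simpa using this
  have hid (t : ℝ) : HasDerivAt (fun t : ℝ ↦ (t : ℂ)) 1 t := by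
    simpa using (hasDerivAt_id (t : ℂ)).comp_ofReal
  have h1 : ∫ t in (-1 : ℝ)..0, (1 + t : ℂ) * Complex.exp (a * t) =
      1 / a - 1 / a ^ 2 + Complex.exp (-a) / a ^ 2 := by
    rw [intervalIntegral.integral_eq_sub_of_hasDerivAt
      (f := fun t : ℝ ↦ (1 + t : ℂ) * Complex.exp (a * t) / a - Complex.exp (a * t) / a ^ 2)]
    · simp
    · intro t _
      convert! (((hid t).const_add 1).mul (hexp t)).div_const a |>.sub
        ((hexp t).div_const (a ^ 2)) using 1
      field_simp
      ring
    · exact Continuous.intervalIntegrable (by fun_prop) _ _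
  have h2 : ∫ t in (0 : ℝ)..1, (1 - t : ℂ) * Complex.exp (a * t) =
      Complex.exp a / a ^ 2 - 1 / a - 1 / a ^ 2 := by
    rw [intervalIntegral.integral_eq_sub_of_hasDerivAt
      (f := fun t : ℝ ↦ (1 - t : ℂ) * Complex.exp (a * t) / a + Complex.exp (a * t) / a ^ 2)]
    · simp; ring
    · intro t _
      convert! (((hid t).const_sub 1).mul (hexp t)).div_const a |>.add
        ((hexp t).div_const (a ^ 2)) using 1
      field_simp
      ring
    · exact Continuous.intervalIntegrable (by fun_prop) _ _
  have hcos : Complex.exp a + Complex.exp (-a) = 2 - 4 * Complex.sin v ^ 2 := by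
    rw [ha, ← neg_mul, Complex.exp_mul_I, Complex.exp_mul_I, Complex.cos_neg, Complex.sin_neg,
      Complex.cos_two_mul, Complex.cos_sq']
    ring
  have hv' : (v : ℂ) ≠ 0 := by exact_mod_cast hv
  have ha2 : a ^ 2 = -4 * v ^ 2 := by rw [ha, mul_pow, mul_pow, Complex.I_sq]; ring
  rw [h1, h2, Real.sinc_of_ne_zero hv]
  push_cast
  calc _ = (Complex.exp a + Complex.exp (-a) - 2) / a ^ 2 := by ring
    _ = _ := by rw [hcos, ha2]; field_simp; ring

theorem integrable_sinc_sq : Integrable fun v ↦ Real.sinc v ^ 2 := by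
  refine (integrable_inv_one_add_sq.const_mul 2).mono'
    (Real.continuous_sinc.pow 2).aestronglyMeasurable (Eventually.of_forall fun v ↦ ?_)
  rw [Real.norm_of_nonneg (sq_nonneg _), ← div_eq_mul_inv, le_div_iff₀ (by positivity)]
  have h1 : Real.sinc v ^ 2 ≤ 1 := by
    rw [sq_le_one_iff_abs_le_one]; exact Real.abs_sinc_le_one v
  have h2 : Real.sinc v ^ 2 * v ^ 2 ≤ 1 := by
    rcases eq_or_ne v 0 with rfl | hv
    · simp
    · rw [Real.sinc_of_ne_zero hv, div_pow, div_mul_cancel₀ _ (by positivity)]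
      exact Real.sin_sq_le_one v
  linarith

theorem integral_sinc_sq_pos : 0 < ∫ v, Real.sinc v ^ 2 := by
  rw [integral_pos_iff_support_of_nonneg (fun v ↦ sq_nonneg _) integrable_sinc_sq]
  exact (Real.continuous_sinc.pow 2).isOpen_support.measure_pos _ ⟨0, by simp⟩

theorem setIntegral_mul_sinc_sq_eq {g : ℝ → ℝ} (hg : Measurable g) {C : ℝ} (hC : ∀ u, |g u| ≤ C)
    {σ l y : ℝ} (hσ : 0 < σ) :
    ((∫ u in Ioi 0, g u * Real.exp (-σ * u) * Real.sinc (l * (y - u)) ^ 2 : ℝ) : ℂ) =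
      ∫ t in (-1 : ℝ)..1, Complex.exp (2 * t * l * y * Complex.I) * (1 - |t| : ℝ) *
        ∫ u in Ioi (0 : ℝ), g u * Complex.exp (-(σ + 2 * l * t * Complex.I) * u) := by
  have hint : IntegrableOn (fun u ↦ g u * Complex.exp (-σ * u)) (Ioi (0 : ℝ)) := by
    refine (integrableOn_exp_mul_complex_Ioi (a := -σ) (by simpa using hσ) 0).bdd_mul
      (c := C) (by fun_prop) (Eventually.of_forall fun u ↦ ?_)
    simpa using hC u
  have hprod : Integrable (Function.uncurry fun (t u : ℝ) ↦ (g u * Complex.exp (-σ * u)) *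
      (((1 - |t| : ℝ) : ℂ) * Complex.exp (2 * t * (l * (y - u)) * Complex.I)))
      ((volume.restrict (Ioc (-1 : ℝ) 1)).prod (volume.restrict (Ioi (0 : ℝ)))) := by
    have hφ : IntegrableOn (fun t : ℝ ↦ ((1 - |t| : ℝ) : ℂ)) (Ioc (-1 : ℝ) 1) :=
      (Continuous.integrableOn_Icc (by fun_prop)).mono_set Ioc_subset_Icc_self
    refine ((hφ.mul_prod hint).mul_bdd (c := 1)
      (g := fun p ↦ Complex.exp (2 * p.1 * (l * (y - p.2)) * Complex.I))
      (by fun_prop) (Eventually.of_forall fun p ↦ ?_)).congr (Eventually.of_forall fun p ↦ ?_)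
    · have := Complex.norm_exp_ofReal_mul_I (2 * p.1 * (l * (y - p.2)))
      push_cast at this
      exact this.le
    · simp only [Function.uncurry]
      ring
  rw [← integral_complex_ofReal]
  have hker (u : ℝ) : ((g u * Real.exp (-σ * u) * Real.sinc (l * (y - u)) ^ 2 : ℝ) : ℂ) =
      ∫ t in (-1 : ℝ)..1, (g u * Complex.exp (-σ * u)) *
        (((1 - |t| : ℝ) : ℂ) * Complex.exp (2 * t * (l * (y - u)) * Complex.I)) := by
    rw [intervalIntegral.integral_const_mul, Complex.ofReal_mul, ← integral_triangle_mul_cexp]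
    push_cast
    rfl
  simp_rw [hker, intervalIntegral.integral_of_le (show (-1 : ℝ) ≤ 1 by norm_num)]
  rw [← integral_integral_swap hprod]
  refine integral_congr_ae (Eventually.of_forall fun t ↦ ?_)
  simp only
  rw [← integral_const_mul]
  refine integral_congr_ae (Eventually.of_forall fun u ↦ ?_)
  simp only
  rw [show -(σ + 2 * l * t * Complex.I) * u = -σ * u + -(2 * t * l * u * Complex.I) by ring,
    show 2 * t * (l * (y - u)) * Complex.I =
      2 * t * l * y * Complex.I + -(2 * t * l * u * Complex.I) by ring,
    Complex.exp_add, Complex.exp_add]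
  ring

theorem integrable_sinc_sq_comp {l : ℝ} (hl : l ≠ 0) (y : ℝ) :
    Integrable fun u ↦ Real.sinc (l * (y - u)) ^ 2 :=
  (integrable_sinc_sq.comp_mul_left' hl).comp_sub_left y

theorem integrable_mul_sinc_sq {g : ℝ → ℝ} (hg : Measurable g) {C : ℝ} (hC : ∀ u, |g u| ≤ C)
    {l : ℝ} (hl : l ≠ 0) (y : ℝ) :
    Integrable fun u ↦ g u * Real.sinc (l * (y - u)) ^ 2 :=
  (integrable_sinc_sq_comp hl y).bdd_mul hg.aestronglyMeasurable (Eventually.of_forall hC)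

theorem setIntegral_mul_sinc_sq_eq_of_continuousOn {g : ℝ → ℝ} (hg : Measurable g) {C : ℝ}
    (hC : ∀ u, |g u| ≤ C) {H : ℂ → ℂ} (hH : ContinuousOn H {z | 0 ≤ z.re})
    (hgH : ∀ z : ℂ, 0 < z.re → ∫ u in Ioi (0 : ℝ), g u * Complex.exp (-z * u) = H z)
    {l : ℝ} (hl : l ≠ 0) (y : ℝ) :
    ((∫ u in Ioi 0, g u * Real.sinc (l * (y - u)) ^ 2 : ℝ) : ℂ) =
      ∫ t in (-1 : ℝ)..1, Complex.exp (2 * t * l * y * Complex.I) * (1 - |t| : ℝ) *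
        H (2 * l * t * Complex.I) := by
  have hleft : Tendsto (fun σ : ℝ ↦ ((∫ u in Ioi 0,
      g u * Real.exp (-σ * u) * Real.sinc (l * (y - u)) ^ 2 : ℝ) : ℂ)) (𝓝[>] 0)
      (𝓝 ((∫ u in Ioi 0, g u * Real.sinc (l * (y - u)) ^ 2 : ℝ) : ℂ)) := by
    refine (Complex.continuous_ofReal.tendsto _).comp ?_
    refine tendsto_integral_filter_of_dominated_convergence
      (fun u ↦ C * Real.sinc (l * (y - u)) ^ 2) ?_ ?_
      ((integrable_sinc_sq_comp hl y).const_mul C).integrableOn ?_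
    · have := Real.continuous_sinc
      exact Eventually.of_forall fun σ ↦ by fun_prop
    · filter_upwards [self_mem_nhdsWithin] with σ hσ
      filter_upwards [ae_restrict_mem measurableSet_Ioi] with u hu
      rw [norm_mul, norm_mul, Real.norm_of_nonneg (sq_nonneg (Real.sinc _)),
        Real.norm_of_nonneg (Real.exp_pos _).le]
      refine mul_le_mul_of_nonneg_right ?_ (sq_nonneg _)
      refine (mul_le_of_le_one_right (norm_nonneg _) ?_).trans (hC u)
      rw [Real.exp_le_one_iff, neg_mul, neg_nonpos]
      exact (mul_pos hσ hu).le
    · refine Eventually.of_forall fun u ↦ ?_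
      have : Continuous fun σ : ℝ ↦
          g u * Real.exp (-σ * u) * Real.sinc (l * (y - u)) ^ 2 := by fun_prop
      simpa using (this.tendsto 0).mono_left nhdsWithin_le_nhds
  have hright : Tendsto (fun σ : ℝ ↦ ∫ t in (-1 : ℝ)..1,
      Complex.exp (2 * t * l * y * Complex.I) * (1 - |t| : ℝ) * H (σ + 2 * l * t * Complex.I))
      (𝓝[>] 0) (𝓝 (∫ t in (-1 : ℝ)..1, Complex.exp (2 * t * l * y * Complex.I) *
        (1 - |t| : ℝ) * H (2 * l * t * Complex.I))) := by
    let K : Set ℂ := (fun p : ℝ × ℝ ↦ (p.1 + 2 * l * p.2 * Complex.I : ℂ)) ''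
      (Icc 0 1 ×ˢ Icc (-1) 1)
    have hK : IsCompact K := (isCompact_Icc.prod isCompact_Icc).image (by fun_prop)
    have hKsub : K ⊆ {z | 0 ≤ z.re} := by
      rintro _ ⟨p, hp, rfl⟩
      simpa using hp.1.1
    obtain ⟨B, hB⟩ := hK.exists_bound_of_continuousOn (hH.mono hKsub)
    refine intervalIntegral.tendsto_integral_filter_of_dominated_convergence (fun _ ↦ B)
      ?_ ?_ (by simp) ?_
    · filter_upwards [self_mem_nhdsWithin] with σ hσ
      refine Continuous.aestronglyMeasurable (Continuous.mul (by fun_prop) ?_)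
      refine hH.comp_continuous (by fun_prop) fun t ↦ ?_
      simpa using (le_of_lt hσ : (0 : ℝ) ≤ σ)
    · filter_upwards [Ioc_mem_nhdsGT (show (0 : ℝ) < 1 by norm_num)] with σ hσ
      refine Eventually.of_forall fun t ht ↦ ?_
      rw [uIoc_of_le (by norm_num)] at ht
      have h1 : ‖Complex.exp (2 * t * l * y * Complex.I)‖ = 1 := by
        have := Complex.norm_exp_ofReal_mul_I (2 * t * l * y)
        push_cast at this
        exact this
      have h2 : ‖((1 - |t| : ℝ) : ℂ)‖ ≤ 1 := by
        have : |t| ≤ 1 := abs_le.2 ⟨ht.1.le, ht.2⟩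
        rw [Complex.norm_real, Real.norm_of_nonneg (by linarith)]
        linarith [abs_nonneg t]
      rw [norm_mul, norm_mul, h1, one_mul]
      refine (mul_le_of_le_one_left (norm_nonneg _) h2).trans (hB _ ?_)
      exact ⟨(σ, t), ⟨⟨hσ.1.le, hσ.2⟩, ⟨ht.1.le, ht.2⟩⟩, rfl⟩
    · refine Eventually.of_forall fun t _ ↦ Tendsto.const_mul _ ?_
      have h0 : (2 * l * t * Complex.I : ℂ) ∈ {z : ℂ | 0 ≤ z.re} := by simp
      refine (hH _ h0).tendsto.comp (tendsto_nhdsWithin_iff.2 ⟨?_, ?_⟩)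
      · have : Continuous fun σ : ℝ ↦ (σ + 2 * l * t * Complex.I : ℂ) := by fun_prop
        simpa using (this.tendsto 0).mono_left nhdsWithin_le_nhds
      · filter_upwards [self_mem_nhdsWithin] with σ hσ
        simpa using (le_of_lt hσ : (0 : ℝ) ≤ σ)
  refine tendsto_nhds_unique hleft (hright.congr' ?_)
  filter_upwards [self_mem_nhdsWithin] with σ hσ
  rw [setIntegral_mul_sinc_sq_eq hg hC hσ]
  refine intervalIntegral.integral_congr fun t _ ↦ ?_
  rw [hgH _ (by simpa using hσ)]

theorem tendsto_setIntegral_mul_sinc_sq {g : ℝ → ℝ} (hg : Measurable g) {C : ℝ}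
    (hC : ∀ u, |g u| ≤ C) {H : ℂ → ℂ} (hH : ContinuousOn H {z | 0 ≤ z.re})
    (hgH : ∀ z : ℂ, 0 < z.re → ∫ u in Ioi (0 : ℝ), g u * Complex.exp (-z * u) = H z)
    {l : ℝ} (hl : 0 < l) :
    Tendsto (fun y ↦ ∫ u in Ioi 0, g u * Real.sinc (l * (y - u)) ^ 2) atTop (𝓝 0) := by
  have hw : Tendsto (fun y : ℝ ↦ -(l / Real.pi) * y) atTop (cocompact ℝ) :=
    (tendsto_id.const_mul_atTop_of_neg (by have := Real.pi_pos; simp; positivity)).mono_right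
      atBot_le_cocompact
  have hRL := (Real.tendsto_integral_exp_smul_cocompact ((Ioc (-1 : ℝ) 1).indicator
    fun t ↦ ((1 - |t| : ℝ) : ℂ) * H (2 * l * t * Complex.I))).comp hw
  have hC' : Tendsto (fun y ↦ ((∫ u in Ioi 0, g u * Real.sinc (l * (y - u)) ^ 2 : ℝ) : ℂ))
      atTop (𝓝 0) := by
    refine hRL.congr fun y ↦ ?_
    rw [setIntegral_mul_sinc_sq_eq_of_continuousOn hg hC hH hgH hl.ne' y,
      intervalIntegral.integral_of_le (by norm_num), ← integral_indicator measurableSet_Ioc]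
    refine integral_congr_ae (Eventually.of_forall fun t ↦ ?_)
    by_cases ht : t ∈ Ioc (-1 : ℝ) 1
    · simp only [indicator_of_mem ht, Circle.smul_def, Real.fourierChar_apply, smul_eq_mul]
      rw [mul_assoc (Complex.exp _)]
      congr 2
      have : (Real.pi : ℂ) ≠ 0 := by exact_mod_cast Real.pi_ne_zero
      push_cast
      field_simp
    · simp [indicator_of_notMem ht]
  simpa [Function.comp_def] using (Complex.continuous_re.tendsto _).comp hC'

theorem tendsto_setIntegral_Ioi_sinc_sq {l : ℝ} (hl : l ≠ 0) :
    Tendsto (fun y ↦ ∫ u in Ioi 0, Real.sinc (l * (y - u)) ^ 2) atTop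
      (𝓝 (∫ v, Real.sinc (l * v) ^ 2)) := by
  have hint : Integrable fun v ↦ Real.sinc (l * v) ^ 2 := integrable_sinc_sq.comp_mul_left' hl
  refine ((aecover_Iio tendsto_id).integral_tendsto_of_countably_generated hint).congr fun y ↦ ?_
  rw [← integral_indicator measurableSet_Iio, ← integral_indicator measurableSet_Ioi,
    ← integral_sub_left_eq_self _ volume y]
  refine integral_congr_ae (Eventually.of_forall fun u ↦ ?_)
  simp [indicator_apply]

theorem exists_mul_integral_sinc_sq_le {h δ : ℝ} (hh : 0 < h) (hδ : 0 < δ) :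
    ∃ l > 0, (1 - δ) * ∫ v, Real.sinc (l * v) ^ 2 ≤ ∫ v in -h..h, Real.sinc (l * v) ^ 2 := by
  have hlim : Tendsto (fun l : ℝ ↦ ∫ v in l * -h..l * h, Real.sinc v ^ 2) atTop
      (𝓝 (∫ v, Real.sinc v ^ 2)) :=
    intervalIntegral_tendsto_integral integrable_sinc_sq
      (tendsto_id.atTop_mul_const_of_neg (by linarith)) (tendsto_id.atTop_mul_const hh)
  have hlt : (1 - δ) * ∫ v, Real.sinc v ^ 2 < ∫ v, Real.sinc v ^ 2 := by
    nlinarith [integral_sinc_sq_pos]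
  obtain ⟨l, hl, hl0⟩ := ((hlim.eventually_const_lt hlt).and (eventually_gt_atTop 0)).exists
  refine ⟨l, hl0, ?_⟩
  rw [Measure.integral_comp_mul_left (fun v ↦ Real.sinc v ^ 2),
    intervalIntegral.integral_comp_mul_left (fun v ↦ Real.sinc v ^ 2) hl0.ne', smul_eq_mul,
    smul_eq_mul, abs_of_pos (inv_pos.2 hl0), mul_left_comm]
  exact mul_le_mul_of_nonneg_left hl.le (inv_pos.2 hl0).le

/-- A Wiener–Ikehara type theorem: a bounded function `f` for which `f u * exp u` is monotone tends
to `1` if the Laplace transform of `f - 1` extends continuously to the closed right half-plane. -/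
theorem tendsto_one_of_laplace_continuousOn {f : ℝ → ℝ} (hf : Measurable f) {C : ℝ}
    (hf0 : ∀ u, 0 ≤ f u) (hfC : ∀ u, f u ≤ C)
    (hmono : ∀ u v, u ≤ v → f u ≤ f v * Real.exp (v - u))
    {H : ℂ → ℂ} (hH : ContinuousOn H {z | 0 ≤ z.re})
    (hfH : ∀ z : ℂ, 0 < z.re →
      ∫ u in Ioi (0 : ℝ), ((f u - 1 : ℝ) : ℂ) * Complex.exp (-z * u) = H z) :
    Tendsto f atTop (𝓝 1) := by
  have hC0 : 0 ≤ C := (hf0 0).trans (hfC 0)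
  have hfint {l : ℝ} (hl : l ≠ 0) (y : ℝ) :
      Integrable fun u ↦ f u * Real.sinc (l * (y - u)) ^ 2 :=
    integrable_mul_sinc_sq hf (fun u ↦ (abs_of_nonneg (hf0 u)).trans_le (hfC u)) hl y
  have hJ {l : ℝ} (hl : 0 < l) :
      Tendsto (fun y ↦ ∫ u in Ioi 0, f u * Real.sinc (l * (y - u)) ^ 2) atTop
        (𝓝 (∫ v, Real.sinc (l * v) ^ 2)) := by
    have hg := tendsto_setIntegral_mul_sinc_sq (hf.sub_const 1) (C := C + 1)
      (fun u ↦ abs_le.2 ⟨by linarith [hf0 u], by linarith [hfC u]⟩) hH hfH hl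
    rw [← zero_add (∫ v, Real.sinc (l * v) ^ 2)]
    refine (hg.add (tendsto_setIntegral_Ioi_sinc_sq hl.ne')).congr fun y ↦ ?_
    simp_rw [sub_mul, one_mul]
    rw [integral_sub (hfint hl.ne' y).integrableOn
      (integrable_sinc_sq_comp hl.ne' y).integrableOn, sub_add_cancel]
  have hT {l : ℝ} (hl : 0 < l) : 0 < ∫ v, Real.sinc (l * v) ^ 2 := by
    rw [Measure.integral_comp_mul_left (fun v ↦ Real.sinc v ^ 2), smul_eq_mul]
    exact mul_pos (by positivity) integral_sinc_sq_pos
  have key {δ : ℝ} (hδ : 0 < δ) :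
      ∀ᶠ u in atTop, f u * (1 - δ) ≤ (1 + δ) ^ 2 ∧ 1 - δ ≤ f u * (1 + δ) + C * δ := by
    obtain ⟨h, hh, hexp⟩ : ∃ h > 0, Real.exp (2 * h) = 1 + δ :=
      ⟨Real.log (1 + δ) / 2, div_pos (Real.log_pos (by linarith)) two_pos, by
        rw [mul_div_cancel₀ _ two_ne_zero, Real.exp_log (by linarith)]⟩
    obtain ⟨l, hl, hlh⟩ := exists_mul_integral_sinc_sq_le hh hδ
    set T := ∫ v, Real.sinc (l * v) ^ 2 with hTdef
    have hTpos : 0 < T := hT hl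
    have hkint (y : ℝ) := integrable_sinc_sq_comp hl.ne' y
    have hwin (y : ℝ) : ∫ u in Ioc (y - h) (y + h), Real.sinc (l * (y - u)) ^ 2 =
        ∫ v in -h..h, Real.sinc (l * v) ^ 2 := by
      rw [← intervalIntegral.integral_of_le (by linarith),
        intervalIntegral.integral_comp_sub_left (fun v ↦ Real.sinc (l * v) ^ 2)]
      simp
    have hup := (tendsto_atTop_add_const_right atTop h tendsto_id).eventually
      ((hJ hl).eventually_lt_const (show T < (1 + δ) * T by nlinarith))
    have hlow := (tendsto_atTop_add_const_right atTop (-h) tendsto_id).eventually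
      ((hJ hl).eventually_const_lt (show (1 - δ) * T < T by nlinarith))
    filter_upwards [hup, hlow, eventually_gt_atTop 0] with w hup hlow hw
    simp only [id] at hup hlow
    constructor
    · have h1 : f w * (∫ v in -h..h, Real.sinc (l * v) ^ 2) ≤
          (1 + δ) * ∫ u in Ioi 0, f u * Real.sinc (l * (w + h - u)) ^ 2 := by
        rw [← hwin (w + h), ← integral_const_mul, ← integral_const_mul]
        refine (setIntegral_mono_on ((hkint _).const_mul _).integrableOn
          ((hfint hl.ne' _).const_mul (1 + δ)).integrableOn measurableSet_Ioc
          fun u hu ↦ ?_).trans (setIntegral_mono_set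
            ((hfint hl.ne' _).const_mul (1 + δ)).integrableOn
            (Eventually.of_forall fun u ↦ ?_) (Eventually.of_forall fun u hu ↦ ?_))
        · rw [← mul_assoc]
          refine mul_le_mul_of_nonneg_right ?_ (sq_nonneg _)
          refine (hmono w u (by linarith [hu.1])).trans ?_
          rw [mul_comm, ← hexp]
          exact mul_le_mul_of_nonneg_right (Real.exp_le_exp.2 (by linarith [hu.2])) (hf0 u)
        · have := hf0 u
          simp only [Pi.zero_apply]
          positivity
        · have : w + h - h < u := hu.1
          show (0 : ℝ) < u
          linarith
      have h2 : f w * ((1 - δ) * T) ≤ (1 + δ) * ((1 + δ) * T) :=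
        (mul_le_mul_of_nonneg_left hlh (hf0 w)).trans
          (h1.trans (mul_le_mul_of_nonneg_left hup.le (by linarith)))
      nlinarith
    · have h1 : ∫ u in Ioi 0, f u * Real.sinc (l * (w + -h - u)) ^ 2 ≤
          f w * (1 + δ) * T + C * (δ * T) := by
        refine (setIntegral_le_integral (hfint hl.ne' _) (Eventually.of_forall fun u ↦
          mul_nonneg (hf0 u) (sq_nonneg _))).trans ?_
        have htot : ∫ u, Real.sinc (l * (w + -h - u)) ^ 2 = T :=
          integral_sub_left_eq_self (fun v ↦ Real.sinc (l * v) ^ 2) volume (w + -h)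
        have hsplit := integral_add_compl (s := Ioc (w + -h - h) (w + -h + h))
          measurableSet_Ioc (hkint (w + -h))
        rw [htot] at hsplit
        have hwin' := hwin (w + -h)
        rw [← integral_add_compl (s := Ioc (w + -h - h) (w + -h + h))
          measurableSet_Ioc (hfint hl.ne' (w + -h))]
        have hin : ∫ u in Ioc (w + -h - h) (w + -h + h), f u * Real.sinc (l * (w + -h - u)) ^ 2 ≤
            f w * (1 + δ) * ∫ u in Ioc (w + -h - h) (w + -h + h),
              Real.sinc (l * (w + -h - u)) ^ 2 := by
          rw [← integral_const_mul]
          refine setIntegral_mono_on (hfint hl.ne' _).integrableOn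
            ((hkint _).const_mul _).integrableOn measurableSet_Ioc fun u hu ↦ ?_
          refine mul_le_mul_of_nonneg_right ?_ (sq_nonneg _)
          refine (hmono u w (by linarith [hu.2])).trans ?_
          rw [← hexp]
          exact mul_le_mul_of_nonneg_left (Real.exp_le_exp.2 (by linarith [hu.1])) (hf0 w)
        have hout : ∫ u in (Ioc (w + -h - h) (w + -h + h))ᶜ,
            f u * Real.sinc (l * (w + -h - u)) ^ 2 ≤
            C * ∫ u in (Ioc (w + -h - h) (w + -h + h))ᶜ, Real.sinc (l * (w + -h - u)) ^ 2 := by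
          rw [← integral_const_mul]
          exact setIntegral_mono (hfint hl.ne' _).integrableOn
            ((hkint _).const_mul _).integrableOn
            fun u ↦ mul_le_mul_of_nonneg_right (hfC u) (sq_nonneg _)
        have hcompl0 : 0 ≤ ∫ u in (Ioc (w + -h - h) (w + -h + h))ᶜ,
            Real.sinc (l * (w + -h - u)) ^ 2 := integral_nonneg fun u ↦ sq_nonneg _
        refine add_le_add (hin.trans (mul_le_mul_of_nonneg_left (by linarith) ?_))
          (hout.trans (mul_le_mul_of_nonneg_left (by linarith) hC0))
        exact mul_nonneg (hf0 w) (by linarith)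
      have h2 := hlow.le.trans h1
      refine le_of_mul_le_mul_right ?_ hTpos
      linarith
  refine tendsto_order.2 ⟨fun a ha ↦ ?_, fun b hb ↦ ?_⟩
  · have hc : Continuous fun δ : ℝ ↦ 1 - δ - C * δ - a * (1 + δ) := by fun_prop
    have hlim := (hc.tendsto 0).mono_left (nhdsWithin_le_nhds (s := Ioi 0))
    obtain ⟨δ, hδ, hδ0⟩ := ((hlim.eventually_const_lt (u := 0) (by simpa using ha)).and
      self_mem_nhdsWithin).exists
    have hδ0 : 0 < δ := hδ0
    filter_upwards [key hδ0] with u hu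
    nlinarith [hu.2]
  · have hc : Continuous fun δ : ℝ ↦ b * (1 - δ) - (1 + δ) ^ 2 := by fun_prop
    have hlim := (hc.tendsto 0).mono_left (nhdsWithin_le_nhds (s := Ioi 0))
    obtain ⟨δ, hδ, hδ0, hδ1⟩ := ((hlim.eventually_const_lt (u := 0)
      (by simpa using hb)).and (Ioo_mem_nhdsGT one_pos)).exists
    filter_upwards [key hδ0] with u hu
    nlinarith [hu.1]

open ArithmeticFunction in
theorem integral_psi_exp_mul_cexp {z : ℂ} (hz : 0 < z.re) :
    ∫ u in Ioi (0 : ℝ), ((Chebyshev.psi (Real.exp u) * Real.exp (-u) : ℝ) : ℂ) *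
      Complex.exp (-z * u) = LSeries (fun n ↦ (Λ n : ℂ)) (1 + z) / (1 + z) := by
  have hO : (fun n : ℕ ↦ ∑ k ∈ Finset.Icc 1 n, Λ k) =O[atTop] fun n ↦ (n : ℝ) ^ (1 : ℝ) := by
    refine Asymptotics.IsBigO.of_bound (Real.log 4 + 4) (Eventually.of_forall fun n ↦ ?_)
    have hpsi : ∑ k ∈ Finset.Icc 1 n, Λ k = Chebyshev.psi n := by
      simp only [Chebyshev.psi, Nat.floor_natCast]
      rfl
    rw [hpsi, Real.norm_of_nonneg (Chebyshev.psi_nonneg _), Real.rpow_one,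
      Real.norm_of_nonneg n.cast_nonneg]
    exact Chebyshev.psi_le_const_mul_self n.cast_nonneg
  have hne : (1 + z : ℂ) ≠ 0 := fun h ↦ by
    have := congrArg Complex.re h
    simp at this
    linarith
  rw [LSeries_eq_mul_integral_of_nonneg _ zero_le_one (by simpa using hz) hO
    fun _ ↦ vonMangoldt_nonneg, mul_div_cancel_left₀ _ hne]
  rw [← Real.exp_zero, ← integral_comp_exp_Ioi]
  refine integral_congr_ae (Eventually.of_forall fun u ↦ ?_)
  have hpsi : (∑ k ∈ Finset.Icc 1 ⌊Real.exp u⌋₊, (Λ k : ℂ)) = Chebyshev.psi (Real.exp u) := by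
    simp only [Chebyshev.psi]
    push_cast
    rfl
  simp only [hpsi]
  have hcpow : (Real.exp u : ℂ) ^ (-(1 + z + 1)) = Complex.exp (-u) * (Complex.exp (-u) *
      Complex.exp (-z * u)) := by
    rw [Complex.cpow_def_of_ne_zero (by exact_mod_cast (Real.exp_pos u).ne'),
      ← Complex.ofReal_log (Real.exp_pos u).le, Real.log_exp, ← Complex.exp_add,
      ← Complex.exp_add]
    ring_nf
  have hexp : Complex.exp u * Complex.exp (-u) = 1 := by
    rw [← Complex.exp_add, add_neg_cancel, Complex.exp_zero]
  rw [hcpow, Complex.real_smul]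
  push_cast
  linear_combination (-(Chebyshev.psi (Real.exp u)) * Complex.exp (-u) *
    Complex.exp (-z * u)) * hexp

open ArithmeticFunction in
theorem exists_continuousOn_LSeries_vonMangoldt :
    ∃ A : ℂ → ℂ, ContinuousOn A {s | 1 ≤ s.re} ∧
      ∀ s : ℂ, 1 < s.re → LSeries (fun n ↦ (Λ n : ℂ)) s = A s + 1 / (s - 1) := by
  refine ⟨vonMangoldt.LFunctionResidueClassAux (1 : ZMod 1),
    vonMangoldt.continuousOn_LFunctionResidueClassAux _,
    fun s hs ↦ ?_⟩
  have hres : (fun n ↦ (Λ n : ℂ)) = fun n ↦ (vonMangoldt.residueClass (1 : ZMod 1) n : ℂ) := by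
    ext n
    have hn : n ∈ {n : ℕ | (n : ZMod 1) = 1} := Subsingleton.elim _ _
    rw [vonMangoldt.residueClass, indicator_of_mem hn]
  have := vonMangoldt.eqOn_LFunctionResidueClassAux (isUnit_one (M := ZMod 1)) hs
  simp only [Nat.totient_one, Nat.cast_one, inv_one] at this
  rw [hres, this, sub_add_cancel]

theorem tendsto_psi_div_id : Tendsto (fun x ↦ Chebyshev.psi x / x) atTop (𝓝 1) := by
  obtain ⟨A, hA, hAL⟩ := exists_continuousOn_LSeries_vonMangoldt
  have hmeas : Measurable fun u ↦ Chebyshev.psi (Real.exp u) * Real.exp (-u) :=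
    (Chebyshev.psi_mono.measurable.comp Real.measurable_exp).mul (by fun_prop)
  have hbound (u : ℝ) : Chebyshev.psi (Real.exp u) * Real.exp (-u) ≤ Real.log 4 + 4 := by
    rw [Real.exp_neg, ← div_eq_mul_inv, div_le_iff₀ (Real.exp_pos u)]
    exact Chebyshev.psi_le_const_mul_self (Real.exp_pos u).le
  have hnonneg (u : ℝ) : 0 ≤ Chebyshev.psi (Real.exp u) * Real.exp (-u) :=
    mul_nonneg (Chebyshev.psi_nonneg _) (Real.exp_pos _).le
  have hlim : Tendsto (fun u ↦ Chebyshev.psi (Real.exp u) * Real.exp (-u)) atTop (𝓝 1) := by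
    refine tendsto_one_of_laplace_continuousOn (H := fun z ↦ (A (1 + z) - 1) / (1 + z))
      hmeas hnonneg hbound (fun u v huv ↦ ?_) ?_ fun z hz ↦ ?_
    · rw [mul_assoc, ← Real.exp_add, show -v + (v - u) = -u by ring]
      exact mul_le_mul_of_nonneg_right (Chebyshev.psi_mono (Real.exp_le_exp.2 huv))
        (Real.exp_pos _).le
    · refine ContinuousOn.div ((hA.comp (by fun_prop) fun z hz ↦ ?_).sub continuousOn_const)
        (by fun_prop) fun z hz h ↦ ?_
      · simpa using hz
      · have h1 := congrArg Complex.re h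
        have h2 : 0 ≤ z.re := hz
        simp at h1
        linarith
    · have hz0 : z ≠ 0 := fun h ↦ by simp [h] at hz
      have hne : (1 + z : ℂ) ≠ 0 := fun h ↦ by
        have := congrArg Complex.re h
        simp at this
        linarith
      have hre : (-z).re < 0 := by simpa using hz
      have hint := integrableOn_exp_mul_complex_Ioi hre 0
      simp_rw [Complex.ofReal_sub, sub_mul, Complex.ofReal_one, one_mul]
      rw [integral_sub _ hint, integral_psi_exp_mul_cexp hz, integral_exp_mul_complex_Ioi hre,
        hAL (1 + z) (by simpa using hz)]
      · simp
        field_simp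
        ring
      · refine hint.bdd_mul (c := Real.log 4 + 4)
          (Complex.measurable_ofReal.comp hmeas).aestronglyMeasurable
          (Eventually.of_forall fun u ↦ ?_)
        rw [Complex.norm_real, Real.norm_of_nonneg (hnonneg u)]
        exact hbound u
  refine (hlim.comp Real.tendsto_log_atTop).congr' ?_
  filter_upwards [eventually_gt_atTop 0] with x hx
  simp [Real.exp_neg, Real.exp_log hx, div_eq_mul_inv]

theorem tendsto_theta_div_id : Tendsto (fun x ↦ Chebyshev.theta x / x) atTop (𝓝 1) := by
  have h : Tendsto (fun x ↦ (Chebyshev.psi x - Chebyshev.theta x) / x) atTop (𝓝 0) := by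
    have h1 := Chebyshev.isBigO_psi_sub_theta_sqrt.mul
      (Asymptotics.isBigO_refl (fun x : ℝ ↦ x⁻¹) atTop)
    refine h1.trans_tendsto (Real.tendsto_sqrt_atTop.inv_tendsto_atTop.congr fun x ↦ ?_)
    rw [← div_eq_mul_inv, Real.sqrt_div_self, Pi.inv_apply]
  simpa [sub_div] using tendsto_psi_div_id.sub h

/-- The **prime number theorem**. -/
theorem tendsto_primeCounting_mul_log_div :
    Tendsto (fun x : ℝ ↦ Nat.primeCounting ⌊x⌋₊ * Real.log x / x) atTop (𝓝 1) := by
  have h : Tendsto (fun x : ℝ ↦ (Nat.primeCounting ⌊x⌋₊ - Chebyshev.theta x / Real.log x) *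
      (Real.log x / x)) atTop (𝓝 0) := by
    have h1 := Chebyshev.primeCounting_sub_theta_div_log_isBigO.mul
      (Asymptotics.isBigO_refl (fun x ↦ Real.log x / x) atTop)
    refine h1.trans_tendsto (Real.tendsto_log_atTop.inv_tendsto_atTop.congr' ?_)
    filter_upwards [eventually_gt_atTop 1] with x hx
    have := (Real.log_pos hx).ne'
    have : x ≠ 0 := by linarith
    simp only [Pi.inv_apply]
    field_simp
  rw [← zero_add (1 : ℝ)]
  refine (h.add tendsto_theta_div_id).congr' ?_
  filter_upwards [eventually_gt_atTop 1] with x hx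
  have := (Real.log_pos hx).ne'
  have : x ≠ 0 := by linarith
  field_simp
  ring

theorem primeCounting_nthPrime {k : ℕ} (hk : 1 ≤ k) : Nat.primeCounting (nthPrime k) = k := by
  rw [Nat.primeCounting, Nat.primeCounting', Nat.count_succ, nthPrime,
    if_pos (Nat.prime_nth_prime _), ← Nat.primeCounting', Nat.primeCounting'_nth_eq]
  omega

theorem lt_nthPrime (k : ℕ) : k < nthPrime k := by
  have := Nat.add_two_le_nth_prime (k - 1)
  rw [nthPrime]
  omega

/-- Quantitative conclusion of Section 3: the requirement
`p_{k+r}/p_k < 1 + t/2` forces `r ≤ k·t`. -/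
theorem prime_ratio_bound_forces_r_small :
    ∀ ε : ℝ, 0 < ε → ε < 1 / 4 → ∃ K : ℕ, ∀ k : ℕ, K ≤ k →
      ∀ r : ℕ, 1 ≤ r → r ≤ k → ∀ t : ℝ, 4 * ε ≤ t → t < 1 →
        (nthPrime (k + r) : ℝ) / (nthPrime k : ℝ) < 1 + t / 2 →
        (r : ℝ) ≤ (k : ℝ) * t := by
  intro ε hε hε'
  have hlow := tendsto_primeCounting_mul_log_div.eventually_const_lt
    (show 1 - ε / 2 < 1 by linarith)
  have hup := tendsto_primeCounting_mul_log_div.eventually_lt_const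
    (show 1 < 1 + ε / 2 by linarith)
  obtain ⟨X, hX⟩ := eventually_atTop.1 (hlow.and hup)
  refine ⟨⌈X⌉₊ + 1, fun k hk r _ _ t ht ht1 hratio ↦ ?_⟩
  set x : ℝ := (nthPrime k : ℝ) with hx
  have hkx : (k : ℝ) < x := Nat.cast_lt.2 (lt_nthPrime k)
  have hk1 : (1 : ℝ) ≤ k := by exact_mod_cast (show 1 ≤ k by omega)
  have hXk : X ≤ k := (Nat.le_ceil X).trans (by exact_mod_cast (show ⌈X⌉₊ ≤ k by omega))
  have hx0 : 0 < x := by linarith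
  have hlog : 0 < Real.log x := Real.log_pos (by linarith)
  set y : ℝ := (1 + t / 2) * x with hy
  have hxy : x ≤ y := by nlinarith
  have hlogxy : Real.log x ≤ Real.log y := Real.log_le_log hx0 hxy
  have hpx : Nat.primeCounting ⌊x⌋₊ = k := by
    rw [hx, Nat.floor_natCast, primeCounting_nthPrime (by omega)]
  have hpy : (k + r : ℝ) ≤ Nat.primeCounting ⌊y⌋₊ := by
    have h := Nat.monotone_primeCounting (Nat.le_floor ((div_lt_iff₀ hx0).1 hratio).le)
    rw [primeCounting_nthPrime (by omega)] at h
    exact_mod_cast h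
  have h1 := (hX x (by linarith)).1
  have h2 := (hX y (by linarith)).2
  rw [hpx, lt_div_iff₀ hx0] at h1
  rw [div_lt_iff₀ (by linarith)] at h2
  have h3 : (k + r : ℝ) * Real.log x ≤ (1 + ε / 2) * ((1 + t / 2) * x) :=
    (mul_le_mul hpy hlogxy hlog.le (Nat.cast_nonneg _)).trans h2.le
  have h4 : (1 + ε / 2) * (1 + t / 2) ≤ (1 - ε / 2) * (1 + t) := by nlinarith
  have h5 : (k + r : ℝ) * Real.log x ≤ (1 + t) * k * Real.log x := by
    calc (k + r : ℝ) * Real.log x ≤ (1 + ε / 2) * (1 + t / 2) * x := by linarith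
      _ ≤ (1 - ε / 2) * (1 + t) * x := mul_le_mul_of_nonneg_right h4 hx0.le
      _ = (1 + t) * ((1 - ε / 2) * x) := by ring
      _ ≤ (1 + t) * (k * Real.log x) := mul_le_mul_of_nonneg_left h1.le (by linarith)
      _ = _ := by ring
  linarith [le_of_mul_le_mul_right h5 hlog]
end

section
/- If n is a largely composite number and n₁ is the smallest highly composite number greater than n, then every integer m with n ≤ m < n₁ and d(m) = d(n) is a largely composite number. -/
/-- No integer below the next HCN after an LCN `n` has more divisors than `n`. -/
theorem LargelyComposite.card_divisors_le_of_lt_next_hcn {n n₁ : ℕ}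
    (hn : LargelyComposite n)
    (hmin : ∀ m : ℕ, HighlyComposite m → n < m → n₁ ≤ m)
    {k : ℕ} (hk : 0 < k) (hkn₁ : k < n₁) : k.divisors.card ≤ n.divisors.card := by
  induction k using Nat.strong_induction_on with
  | _ k ih =>
    rcases lt_trichotomy k n with h | rfl | h
    · exact hn.2 k hk h
    · exact le_rfl
    · by_contra! hlt
      have hcn : HighlyComposite k :=
        ⟨hk, fun j hj hjk => (ih j hjk hj (hjk.trans hkn₁)).trans_lt hlt⟩
      exact (hmin k hcn h).not_gt hkn₁

/-- Between an LCN `n` and the next HCN `n₁`, any integer with the same divisor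
count as `n` is again an LCN. -/
theorem lcn_between_lcn_and_next_hcn (n n₁ : ℕ)
    (hn : LargelyComposite n)
    (hn₁ : HighlyComposite n₁) (hnn₁ : n < n₁)
    (hmin : ∀ m : ℕ, HighlyComposite m → n < m → n₁ ≤ m) :
    ∀ m : ℕ, n ≤ m → m < n₁ → m.divisors.card = n.divisors.card →
      LargelyComposite m := by
  intro m hnm hmn₁ hm
  refine ⟨hn.1.trans_le hnm, fun k hk hkm => ?_⟩
  rw [hm]
  exact hn.card_divisors_le_of_lt_next_hcn hmin hk (hkm.trans hmn₁)
end
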